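/- Let G be the graph on seven vertices v1, …, v7 whose edges are all unordered pairs of distinct vertices except (v5,v7) and (v6,v7) (i.e., K_7 minus two edges incident to the common vertex v7, so that v7 is adjacent exactly to v1, v2, v3, v4), and let w be a ℤ/2-edge-weighting of G. Suppose that for every 4-element subset S of {v1, …, v6}, the induced complete subgraph of G on S contains an odd cycle. Then G contains two vertex-disjoint odd cycles. -/

import Mathlib

open SimpleGraph

/-- `K₇` minus the two adjacent edges `(v5,v7)` and `(v6,v7)`, where `vᵢ = (i-1 : Fin 7)`;
so `v7 = 6` is adjacent exactly to `v1, v2, v3, v4`. -/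
def K7mAdj : SimpleGraph (Fin 7) :=
  (completeGraph (Fin 7)).deleteEdges {s(4, 6), s(5, 6)}

/-- The ℤ/2-weight of a closed walk: the sum of the weights of its edges. -/
def cycWeight (w : Sym2 (Fin 7) → ZMod 2) {v : Fin 7} (c : K7mAdj.Walk v v) : ZMod 2 :=
  (c.edges.map w).sum

/-- If the weight on every edge inside `S` is the coboundary of `f`, then the weight of a walk
inside `S` only depends on the values of `f` at its endpoints. -/
theorem sum_edges_eq_of_coboundary {V : Type*} {G : SimpleGraph V} (w : Sym2 V → ZMod 2)
    (f : V → ZMod 2) (S : Set V)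
    (hf : ∀ a ∈ S, ∀ b ∈ S, G.Adj a b → w s(a, b) = f a + f b)
    {u v : V} (p : G.Walk u v) (hp : ∀ x ∈ p.support, x ∈ S) :
    (p.edges.map w).sum = f u + f v := by
  induction p with
  | nil => simp [CharTwo.add_self_eq_zero]
  | @cons a b c hab q ih =>
    have hq : ∀ x ∈ q.support, x ∈ S := fun x hx => hp x (by simp [hx])
    simp only [Walk.edges_cons, List.map_cons, List.sum_cons]
    rw [ih hq, hf a (hp a (by simp)) b (hq b q.start_mem_support) hab]
    linear_combination CharTwo.add_self_eq_zero (f b)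

/-- A triangle, as a closed walk, is a cycle. -/
theorem isCycle_triangle {V : Type*} {G : SimpleGraph V} {a b c : V}
    (hab : G.Adj a b) (hbc : G.Adj b c) (hca : G.Adj c a) :
    (Walk.cons hab (.cons hbc (.cons hca .nil))).IsCycle := by
  have h₁ := hab.ne
  have h₂ := hbc.ne
  have h₃ := hca.ne
  rw [Walk.cons_isCycle_iff]
  constructor
  · simp [h₁.symm, h₂, h₃]
  · simp [h₁, h₁.symm, h₂, h₃.symm]

/-- let `G = K₇ - (v5,v7) - (v6,v7)` with a ℤ/2-edge-weighting `w`.  If for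
every 4-element subset `S` of `{v1,…,v6}` the induced complete subgraph on `S` (i.e. the
cycles of `G` supported in `S`) contains an odd cycle, then `G` has two vertex-disjoint
odd cycles. -/
theorem stmt8 (w : Sym2 (Fin 7) → ZMod 2)
    (h : ∀ S : Finset (Fin 7), S.card = 4 → (6 : Fin 7) ∉ S →
      ∃ (v : Fin 7) (c : K7mAdj.Walk v v), c.IsCycle ∧ (∀ x ∈ c.support, x ∈ S) ∧
        cycWeight w c = 1) :
    ∃ (u v : Fin 7) (c1 : K7mAdj.Walk u u) (c2 : K7mAdj.Walk v v),
      c1.IsCycle ∧ c2.IsCycle ∧ cycWeight w c1 = 1 ∧ cycWeight w c2 = 1 ∧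
      ∀ x, ¬(x ∈ c1.support ∧ x ∈ c2.support) := by
  have hadj : ∀ a b : Fin 7, a ≠ b → a < 4 → K7mAdj.Adj a b := by
    simp only [K7mAdj, deleteEdges_adj, completeGraph_eq_top, top_adj]
    decide
  by_cases hodd : ∃ a b : Fin 7, a < 4 ∧ b < 4 ∧ a ≠ b ∧ w s(6, a) + w s(a, b) + w s(b, 6) = 1
  · obtain ⟨a, b, ha, hb, hab, hw⟩ := hodd
    have ha6 : a ≠ 6 := by rintro rfl; exact absurd ha (by decide)
    have hb6 : b ≠ 6 := by rintro rfl; exact absurd hb (by decide)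
    have hcard : ({6, a, b} : Finset (Fin 7))ᶜ.card = 4 := by
      rw [Finset.card_compl, Finset.card_eq_three.2 ⟨6, a, b, ha6.symm, hb6.symm, hab, rfl⟩]
      rfl
    obtain ⟨v, c, hc, hS, hcw⟩ := h _ hcard (by simp)
    refine ⟨6, v, .cons (hadj a 6 ha6 ha).symm (.cons (hadj a b hab ha)
      (.cons (hadj b 6 hb6 hb) .nil)), c, isCycle_triangle _ _ _, hc, ?_, hcw, ?_⟩
    · simpa [cycWeight, add_assoc] using hw
    · rintro x ⟨hx, hxc⟩
      have := hS x hxc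
      simp at hx this
      tauto
  · push Not at hodd
    obtain ⟨v, c, -, hS, hcw⟩ := h {0, 1, 2, 3} (by decide) (by decide)
    have hlt : ∀ x ∈ ({0, 1, 2, 3} : Finset (Fin 7)), x < 4 := by decide
    have hcob : ∀ a ∈ {x : Fin 7 | x < 4}, ∀ b ∈ {x : Fin 7 | x < 4}, K7mAdj.Adj a b →
        w s(a, b) = w s(6, a) + w s(6, b) := by
      intro a ha b hb hab
      have hne := hodd a b ha hb hab.ne
      rw [Sym2.eq_swap (a := b) (b := 6)] at hne
      generalize w s(a, b) = x at *
      generalize w s(6, a) = y at *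
      generalize w s(6, b) = z at *
      revert x y z
      decide
    have hzero := sum_edges_eq_of_coboundary w (fun a => w s(6, a)) {x | x < 4} hcob c
      fun x hx => hlt x (hS x hx)
    rw [CharTwo.add_self_eq_zero] at hzero
    exact absurd (hcw.symm.trans hzero) one_ne_zero
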